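/- arXiv:1707.08086 — 2 statements merged into one kernel-verified Lean document; each statement's English description precedes it below -/
import Mathlib

section
/- For every fixed a ∈ [0,1], the function t ↦ Q(a·t)/Q(t) is nondecreasing on [0,∞): for all 0 ≤ t₁ ≤ t₂ one has Q(a·t₁)/Q(t₁) ≤ Q(a·t₂)/Q(t₂). -/
open MeasureTheory ProbabilityTheory Real

/-- Standard Gaussian upper tail probability. -/
noncomputable def Q (t : ℝ) : ℝ := ((gaussianReal 0 1) (Set.Ioi t)).toReal

lemma Q_eq (t : ℝ) : Q t = ∫ x in Set.Ioi t, gaussianPDFReal 0 1 x := by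
  rw [Q, gaussianReal_apply_eq_integral _ one_ne_zero, ENNReal.toReal_ofReal]
  exact integral_nonneg fun x => gaussianPDFReal_nonneg _ _ _

lemma Q_pos (t : ℝ) : 0 < Q t := by
  rw [Q_eq, setIntegral_pos_iff_support_of_nonneg_ae]
  · have : Function.support (gaussianPDFReal 0 1) = Set.univ := by
      ext x
      simp [(gaussianPDFReal_pos 0 1 x one_ne_zero).ne']
    rw [this]
    simp
  · exact Filter.Eventually.of_forall fun x => gaussianPDFReal_nonneg _ _ _
  · exact (integrable_gaussianPDFReal _ _).integrableOn

lemma Q_anti {s t : ℝ} (h : s ≤ t) : Q t ≤ Q s :=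
  ENNReal.toReal_mono (measure_ne_top _ _) (measure_mono (Set.Ioi_subset_Ioi h))

lemma pdf_shift (d x : ℝ) :
    gaussianPDFReal 0 1 (x + d) = exp (-d * x - d ^ 2 / 2) * gaussianPDFReal 0 1 x := by
  simp only [gaussianPDFReal]
  rw [mul_left_comm, ← Real.exp_add]
  congr 2
  simp
  ring

lemma intg (d : ℝ) : Integrable (fun x => gaussianPDFReal 0 1 (x + d)) :=
  (integrable_gaussianPDFReal 0 1).comp_add_right d

lemma Q_shift (d t : ℝ) : Q (t + d) = ∫ x in Set.Ioi t, gaussianPDFReal 0 1 (x + d) := by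
  rw [Q_eq]
  have := (measurePreserving_add_right (volume : Measure ℝ) d).setIntegral_preimage_emb
    (measurableEmbedding_addRight d) (gaussianPDFReal 0 1) (Set.Ioi (t + d))
  rw [← this]
  simp

lemma Q_split (d : ℝ) {s t : ℝ} (h : s ≤ t) :
    Q (s + d) = (∫ x in Set.Ioc s t, gaussianPDFReal 0 1 (x + d)) + Q (t + d) := by
  rw [Q_shift, Q_shift, ← Set.Ioc_union_Ioi_eq_Ioi h]
  exact setIntegral_union (Set.Ioc_disjoint_Ioi le_rfl) measurableSet_Ioi
    (intg d).integrableOn (intg d).integrableOn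

lemma Q_logconcave {s t d : ℝ} (h : s ≤ t) (hd : 0 ≤ d) :
    Q (t + d) * Q s ≤ Q (s + d) * Q t := by
  have h1 := Q_split d h
  have h2 := Q_split 0 h
  simp only [add_zero] at h2
  set g := exp (-d * t - d ^ 2 / 2)
  have hA : g * (∫ x in Set.Ioc s t, gaussianPDFReal 0 1 x) ≤
      ∫ x in Set.Ioc s t, gaussianPDFReal 0 1 (x + d) := by
    rw [← integral_const_mul]
    refine setIntegral_mono_on ((integrable_gaussianPDFReal 0 1).const_mul g).integrableOn
      (intg d).integrableOn measurableSet_Ioc fun x hx => ?_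
    rw [pdf_shift]
    refine mul_le_mul_of_nonneg_right (exp_le_exp.2 ?_) (gaussianPDFReal_nonneg _ _ _)
    nlinarith [mul_le_mul_of_nonneg_left hx.2 hd]
  have hB : Q (t + d) ≤ g * Q t := by
    rw [Q_shift, Q_eq, ← integral_const_mul]
    refine setIntegral_mono_on (intg d).integrableOn
      ((integrable_gaussianPDFReal 0 1).const_mul g).integrableOn measurableSet_Ioi fun x hx => ?_
    rw [pdf_shift]
    refine mul_le_mul_of_nonneg_right (exp_le_exp.2 ?_) (gaussianPDFReal_nonneg _ _ _)
    nlinarith [mul_le_mul_of_nonneg_left (le_of_lt hx) hd]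
  have hA0 : 0 ≤ ∫ x in Set.Ioc s t, gaussianPDFReal 0 1 x :=
    integral_nonneg fun x => gaussianPDFReal_nonneg _ _ _
  rw [h1, h2]
  have e1 := mul_le_mul_of_nonneg_right hA (Q_pos t).le
  have e2 := mul_le_mul_of_nonneg_right hB hA0
  linarith

theorem Q_ratio_monotone (a : ℝ) (ha0 : 0 ≤ a) (ha1 : a ≤ 1) :
    ∀ t₁ t₂ : ℝ, 0 ≤ t₁ → t₁ ≤ t₂ → Q (a * t₁) / Q t₁ ≤ Q (a * t₂) / Q t₂ := by
  intro t₁ t₂ h0 h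
  rw [div_le_div_iff₀ (Q_pos _) (Q_pos _)]
  have hs : a * t₁ ≤ t₁ := by nlinarith
  have hd : 0 ≤ a * (t₂ - t₁) := mul_nonneg ha0 (by linarith)
  have k := Q_logconcave hs hd
  rw [show a * t₁ + a * (t₂ - t₁) = a * t₂ by ring] at k
  have k2 : Q t₂ ≤ Q (t₁ + a * (t₂ - t₁)) := Q_anti (by nlinarith)
  nlinarith [mul_le_mul_of_nonneg_right k2 (Q_pos (a * t₁)).le]
end

section
/- (Converse for non-interactive list common randomness generation.) Let ε ∈ (0, 1/2], let n ≥ 1 and b ≥ 1 be integers, let κ > 0 be a real with log₂ b ≤ 4·ε·(1−ε)·κ, and let (X,Y) ∼ DSBS(1−2ε)^⊗n. Let S be a finite set, let f : {0,1}^n → S satisfy P(f(X) = z) ≤ 2^{−κ} for every z ∈ S (i.e. f(X) has min-entropy at least κ bits), and let g₁,…,g_b : {0,1}^n → S be arbitrary functions. Then P(∃ i ∈ {1,…,b}, f(X) = g_i(Y)) ≤ 2^{−ν·κ}, where ν = (√(1 − (log₂ b)/κ) − (1−2ε))² / (4·ε·(1−ε)). -/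
open MeasureTheory ProbabilityTheory Real

/-- The distribution of a single coordinate pair of the doubly symmetric binary source
`DSBS(1-2ε)`: a uniform bit together with its ε-noisy copy. -/
noncomputable def dsbsPair (ε : ℝ) : Measure (Bool × Bool) :=
  ENNReal.ofReal ((1 - ε) / 2) • Measure.dirac (false, false) +
  ENNReal.ofReal ((1 - ε) / 2) • Measure.dirac (true, true) +
  ENNReal.ofReal (ε / 2) • Measure.dirac (false, true) +
  ENNReal.ofReal (ε / 2) • Measure.dirac (true, false)

/-- The distribution `DSBS(1-2ε)^⊗n` on pairs of `n`-bit strings. -/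
noncomputable def dsbs (ε : ℝ) (n : ℕ) : Measure ((Fin n → Bool) × (Fin n → Bool)) :=
  (Measure.pi fun _ : Fin n => dsbsPair ε).map
    (fun f => (fun i => (f i).1, fun i => (f i).2))

lemma rchoose_succ (r : ℝ) (k : ℕ) :
    Ring.choose r (k + 1) = Ring.choose r k * (r - k) / (k + 1) := by
  have h := Ring.choose_smul_choose r (Nat.le_succ k)
  simp only [Nat.succ_eq_add_one, Nat.choose_succ_self_right, nsmul_eq_mul,
    Nat.add_sub_cancel_left, Ring.choose_one_right] at h
  push_cast at h
  field_simp
  linarith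

lemma hasSum_binom (a x : ℝ) (hx : |x| < 1) :
    HasSum (fun n : ℕ => Ring.choose a n * x ^ n) ((1 + x) ^ a) := by
  have h := (Real.one_add_rpow_hasFPowerSeriesOnBall_zero (a := a)).hasSum (y := x)
    (by simpa [enorm_eq_nnnorm] using! hx)
  simpa [binomialSeries, mul_comm] using h

lemma binom_coeff_le {p q r : ℝ} (hp : 1 < p) (hpq : p ≤ q) (hq : q ≤ 2) (hr : 0 ≤ r)
    (hr2 : r ^ 2 * (q - 1) = p - 1) (k : ℕ) :
    0 ≤ Ring.choose q (2 * (k + 1)) ∧ 0 ≤ Ring.choose p (2 * (k + 1)) ∧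
    Ring.choose q (2 * (k + 1)) * r ^ (2 * (k + 1)) ≤ q / p * Ring.choose p (2 * (k + 1)) := by
  have hr1 : r ^ 2 ≤ 1 := by
    by_contra hc
    push Not at hc
    nlinarith
  induction k with
  | zero =>
    have e : ∀ s : ℝ, Ring.choose s (2 * (0 + 1)) = s * (s - 1) / 2 := by
      intro s
      rw [show 2 * (0 + 1) = 1 + 1 by norm_num, rchoose_succ, Ring.choose_one_right]
      norm_num
    rw [e, e]
    refine ⟨by nlinarith, by nlinarith, ?_⟩
    have : q / p * (p * (p - 1) / 2) = q * (p - 1) / 2 := by field_simp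
    rw [this, ← hr2]
    norm_num
    nlinarith
  | succ k ih =>
    obtain ⟨h1, h2, h3⟩ := ih
    have e : ∀ s : ℝ, Ring.choose s (2 * (k + 1 + 1)) = Ring.choose s (2 * (k + 1)) *
        ((2 * (k + 1) - s) * (2 * (k + 1) + 1 - s) / ((2 * (k + 1) + 1) * (2 * (k + 1) + 2))) := by
      intro s
      rw [show 2 * (k + 1 + 1) = 2 * (k + 1) + 1 + 1 by ring, rchoose_succ, rchoose_succ]
      push_cast
      field_simp
      ring
    rw [e, e]
    have hk : (0 : ℝ) ≤ k := Nat.cast_nonneg k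
    have hA : 0 ≤ (2 * (k + 1) - q) * (2 * (k + 1) + 1 - q) :=
      mul_nonneg (by linarith) (by linarith)
    have hAB : (2 * (k + 1) - q) * (2 * (k + 1) + 1 - q) ≤
        (2 * (k + 1) - p) * (2 * (k + 1) + 1 - p) :=
      mul_le_mul (by linarith) (by linarith) (by linarith) (by linarith)
    set A := (2 * ((k : ℝ) + 1) - q) * (2 * (k + 1) + 1 - q)
    set B := (2 * ((k : ℝ) + 1) - p) * (2 * (k + 1) + 1 - p)
    have hD : 0 < (2 * ((k : ℝ) + 1) + 1) * (2 * (k + 1) + 2) := by positivity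
    set D := (2 * ((k : ℝ) + 1) + 1) * (2 * (k + 1) + 2)
    have hB : 0 ≤ B := hA.trans hAB
    have hq0 : 0 < q := by linarith
    have hp0 : 0 < p := by linarith
    refine ⟨by positivity, by positivity, ?_⟩
    calc _ = (Ring.choose q (2 * (k + 1)) * r ^ (2 * (k + 1))) * (A / D * r ^ 2) := by ring
      _ ≤ (q / p * Ring.choose p (2 * (k + 1))) * (B / D) := by
        refine mul_le_mul h3 ?_ (by positivity) (by positivity)
        calc A / D * r ^ 2 ≤ A / D * 1 := by gcongr
          _ ≤ B / D := by rw [mul_one]; gcongr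
      _ = _ := by ring

lemma bonami_core {p q r y : ℝ} (hp : 1 < p) (hpq : p ≤ q) (hq : q ≤ 2) (hr : 0 ≤ r)
    (hr2 : r ^ 2 * (q - 1) = p - 1) (hy : |y| < 1) :
    ((1 + r * y) ^ q + (1 - r * y) ^ q) / 2 ≤
      (((1 + y) ^ p + (1 - y) ^ p) / 2) ^ (q / p) := by
  have hr1 : r ≤ 1 := by
    by_contra hc
    push Not at hc
    nlinarith [mul_pos (show 0 < r - 1 by linarith) (show 0 < r + 1 by linarith)]
  have hry : |r * y| < 1 := by
    rw [abs_mul, abs_of_nonneg hr]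
    nlinarith [abs_nonneg y]
  have s1 := hasSum_binom p y hy
  have s2 := hasSum_binom p (-y) (by simpa using hy)
  have s3 := hasSum_binom q (r * y) hry
  have s4 := hasSum_binom q (-(r * y)) (by simpa using hry)
  have S := ((s1.add s2).mul_left (q / p / 2)).sub ((s3.add s4).mul_left (1 / 2))
  have key := sum_le_hasSum {0} (fun i hi => ?_) S
  · simp only [Finset.sum_singleton, Ring.choose_zero_right, pow_zero] at key
    set X := ((1 + y) ^ p + (1 - y) ^ p) / 2 with hX
    have hXn : 0 ≤ X := by
      have := abs_lt.1 hy
      have h1 : 0 ≤ 1 + y := by linarith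
      have h2 : 0 ≤ 1 - y := by linarith
      positivity
    have hb := one_add_mul_self_le_rpow_one_add (s := X - 1) (by linarith) (p := q / p)
      (by rw [le_div_iff₀ (by linarith)]; linarith)
    rw [add_sub_cancel] at hb
    refine le_trans ?_ hb
    rw [← sub_eq_add_neg, ← sub_eq_add_neg] at key
    have : q / p * (X - 1) = q / p / 2 * ((1 + y) ^ p + (1 - y) ^ p) - q / p := by
      rw [hX]; ring
    rw [this]
    linarith
  · rcases Nat.even_or_odd i with he | ho
    · obtain ⟨k, rfl⟩ := he
      have hk : k ≠ 0 := by rintro rfl; simp at hi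
      obtain ⟨j, rfl⟩ := Nat.exists_eq_succ_of_ne_zero hk
      obtain ⟨-, -, h3⟩ := binom_coeff_le hp hpq hq hr hr2 j
      rw [show j.succ + j.succ = 2 * (j + 1) by simp; ring]
      have ev : Even (2 * (j + 1)) := by simp
      rw [ev.neg_pow, ev.neg_pow, mul_pow]
      have hy2 : 0 ≤ y ^ (2 * (j + 1)) := ev.pow_nonneg y
      nlinarith [mul_le_mul_of_nonneg_right h3 hy2]
    · rw [ho.neg_pow, ho.neg_pow]
      apply le_of_eq; ring

lemma bonami_pos {p q r a b : ℝ} (hp : 1 < p) (hpq : p ≤ q) (hq : q ≤ 2) (hr : 0 ≤ r)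
    (hr2 : r ^ 2 * (q - 1) = p - 1) (ha : 0 < a) (hb : 0 < b) :
    ((((1 + r) / 2 * a + (1 - r) / 2 * b) ^ q + ((1 - r) / 2 * a + (1 + r) / 2 * b) ^ q) / 2)
      ^ (1 / q) ≤ ((a ^ p + b ^ p) / 2) ^ (1 / p) := by
  have hr1 : r ≤ 1 := by
    by_contra hc
    push Not at hc
    nlinarith [mul_pos (show 0 < r - 1 by linarith) (show 0 < r + 1 by linarith)]
  set M := (a + b) / 2 with hM
  have hM0 : 0 < M := by positivity
  set y := (a - b) / (a + b) with hyd
  have hab : 0 < a + b := by positivity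
  have hy : |y| < 1 := by
    rw [abs_lt, hyd, lt_div_iff₀ hab, div_lt_iff₀ hab]
    constructor <;> linarith
  have hy' := abs_lt.1 hy
  have e1 : a = M * (1 + y) := by rw [hM, hyd]; field_simp; ring
  have e2 : b = M * (1 - y) := by rw [hM, hyd]; field_simp; ring
  have hy1 : -1 ≤ r * y := by nlinarith
  have hy2 : r * y ≤ 1 := by nlinarith
  have e3 : (1 + r) / 2 * a + (1 - r) / 2 * b = M * (1 + r * y) := by rw [e1, e2]; ring
  have e4 : (1 - r) / 2 * a + (1 + r) / 2 * b = M * (1 - r * y) := by rw [e1, e2]; ring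
  have hq0 : 0 < q := by linarith
  have hp0 : 0 < p := by linarith
  have h1 : 0 ≤ 1 + y := by linarith
  have h2 : 0 ≤ 1 - y := by linarith
  have h3 : 0 ≤ 1 + r * y := by linarith
  have h4 : 0 ≤ 1 - r * y := by linarith
  rw [e3, e4, e1, e2, mul_rpow hM0.le h1, mul_rpow hM0.le h2, mul_rpow hM0.le h3,
    mul_rpow hM0.le h4, ← mul_add, ← mul_add, mul_div_assoc, mul_div_assoc,
    mul_rpow (by positivity) (by positivity), mul_rpow (by positivity) (by positivity),
    ← rpow_mul hM0.le, ← rpow_mul hM0.le, mul_one_div_cancel hq0.ne', mul_one_div_cancel hp0.ne']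
  refine mul_le_mul_of_nonneg_left ?_ (by positivity)
  calc _ ≤ ((((1 + y) ^ p + (1 - y) ^ p) / 2) ^ (q / p)) ^ (1 / q) :=
        rpow_le_rpow (by positivity) (bonami_core hp hpq hq hr hr2 hy) (by positivity)
    _ = _ := by
        rw [← rpow_mul (by positivity)]
        congr 1
        field_simp

lemma bonami {p q r a b : ℝ} (hp : 1 < p) (hpq : p ≤ q) (hq : q ≤ 2) (hr : 0 ≤ r)
    (hr2 : r ^ 2 * (q - 1) = p - 1) (ha : 0 ≤ a) (hb : 0 ≤ b) :
    ((((1 + r) / 2 * a + (1 - r) / 2 * b) ^ q + ((1 - r) / 2 * a + (1 + r) / 2 * b) ^ q) / 2)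
      ^ (1 / q) ≤ ((a ^ p + b ^ p) / 2) ^ (1 / p) := by
  have hq0 : 0 < q := by linarith
  have hp0 : 0 < p := by linarith
  have hq1 : 0 ≤ 1 / q := by positivity
  have hp1 : 0 ≤ 1 / p := by positivity
  have c1 : Continuous fun d : ℝ => ((((1 + r) / 2 * (a + d) + (1 - r) / 2 * (b + d)) ^ q +
      ((1 - r) / 2 * (a + d) + (1 + r) / 2 * (b + d)) ^ q) / 2) ^ (1 / q) := by
    refine Continuous.rpow_const ?_ (fun _ => Or.inr hq1)
    refine Continuous.div_const (Continuous.add ?_ ?_) _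
    · exact Continuous.rpow_const (by fun_prop) (fun _ => Or.inr hq0.le)
    · exact Continuous.rpow_const (by fun_prop) (fun _ => Or.inr hq0.le)
  have c2 : Continuous fun d : ℝ => (((a + d) ^ p + (b + d) ^ p) / 2) ^ (1 / p) := by
    refine Continuous.rpow_const ?_ (fun _ => Or.inr hp1)
    refine Continuous.div_const (Continuous.add ?_ ?_) _
    · exact Continuous.rpow_const (by fun_prop) (fun _ => Or.inr hp0.le)
    · exact Continuous.rpow_const (by fun_prop) (fun _ => Or.inr hp0.le)
  have t1 := (c1.tendsto 0).mono_left (nhdsWithin_le_nhds (s := Set.Ioi 0))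
  have t2 := (c2.tendsto 0).mono_left (nhdsWithin_le_nhds (s := Set.Ioi 0))
  have := le_of_tendsto_of_tendsto t1 t2 (by
    filter_upwards [self_mem_nhdsWithin] with d hd
    have hd' : 0 < d := hd
    exact bonami_pos hp hpq hq hr hr2 (by linarith) (by linarith))
  simpa only [add_zero] using this

lemma holder2 {p q : ℝ} (h : p.HolderConjugate q) {a b c d : ℝ} (ha : 0 ≤ a) (hb : 0 ≤ b)
    (hc : 0 ≤ c) (hd : 0 ≤ d) :
    (a * c + b * d) / 2 ≤ ((a ^ p + b ^ p) / 2) ^ (1 / p) * ((c ^ q + d ^ q) / 2) ^ (1 / q) := by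
  have := Real.inner_le_Lp_mul_Lq_of_nonneg (Finset.univ : Finset (Fin 2)) (f := ![a, b])
    (g := ![c, d]) h (by intro i _; fin_cases i <;> simpa) (by intro i _; fin_cases i <;> simpa)
  simp only [Fin.sum_univ_two, Matrix.cons_val_zero, Matrix.cons_val_one] at this
  rw [div_rpow (by positivity) (by norm_num), div_rpow (by positivity) (by norm_num),
    div_mul_div_comm, ← rpow_add (by norm_num), one_div, one_div, h.inv_add_inv_eq_one, rpow_one]
  simp only [one_div] at this
  gcongr

lemma two_point_aux {p q r a b c d : ℝ} (hp : 1 < p) (hq : 2 ≤ q) (hr : 0 ≤ r) (hr1 : r ≤ 1)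
    (hr2 : (p - 1) * (q - 1) = r ^ 2) (ha : 0 ≤ a) (hb : 0 ≤ b) (hc : 0 ≤ c) (hd : 0 ≤ d) :
    (1 + r) / 4 * (a * c + b * d) + (1 - r) / 4 * (a * d + b * c) ≤
      ((a ^ p + b ^ p) / 2) ^ (1 / p) * ((c ^ q + d ^ q) / 2) ^ (1 / q) := by
  have hq1 : 0 < q - 1 := by linarith
  have hconj : (q / (q - 1)).HolderConjugate q :=
    (Real.HolderConjugate.conjExponent (by linarith : 1 < q)).symm
  have e : q / (q - 1) - 1 = 1 / (q - 1) := by field_simp; ring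
  have h0 : 0 ≤ (1 + r) / 2 := by linarith
  have h0' : 0 ≤ (1 - r) / 2 := by linarith
  have hB := bonami (p := p) (q := q / (q - 1)) (r := r) hp ?_ ?_ hr ?_ ha hb
  · refine le_trans ?_ ((holder2 hconj (a := (1 + r) / 2 * a + (1 - r) / 2 * b)
      (b := (1 - r) / 2 * a + (1 + r) / 2 * b) (by positivity) (by positivity) hc hd).trans
      (mul_le_mul_of_nonneg_right hB (by positivity)))
    apply le_of_eq; ring
  · have : p - 1 ≤ q / (q - 1) - 1 := by
      rw [e, le_div_iff₀ hq1, hr2]; nlinarith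
    linarith
  · rw [div_le_iff₀ hq1]; linarith
  · rw [e, ← hr2]; field_simp

lemma two_point {p q r a b c d : ℝ} (hp : 1 < p) (hq : 1 < q) (hr : 0 ≤ r) (hr1 : r ≤ 1)
    (hr2 : (p - 1) * (q - 1) = r ^ 2) (ha : 0 ≤ a) (hb : 0 ≤ b) (hc : 0 ≤ c) (hd : 0 ≤ d) :
    (1 + r) / 4 * (a * c + b * d) + (1 - r) / 4 * (a * d + b * c) ≤
      ((a ^ p + b ^ p) / 2) ^ (1 / p) * ((c ^ q + d ^ q) / 2) ^ (1 / q) := by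
  rcases le_total 2 q with h2 | h2
  · exact two_point_aux hp h2 hr hr1 hr2 ha hb hc hd
  rcases le_total 2 p with h3 | h3
  · have := two_point_aux hq h3 hr hr1 (by rw [mul_comm]; exact hr2) hc hd ha hb
    rw [mul_comm (((c ^ q + d ^ q) / 2) ^ (1 / q))] at this
    refine le_trans (le_of_eq ?_) this
    ring
  have hs : √(p - 1) * √(q - 1) = r := by
    rw [← Real.sqrt_mul (by linarith), hr2, Real.sqrt_sq hr]
  have b1 := bonami (q := 2) (r := √(p - 1)) hp h3 le_rfl (Real.sqrt_nonneg _)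
    (by rw [Real.sq_sqrt (by linarith)]; ring) ha hb
  have b2 := bonami (q := 2) (r := √(q - 1)) hq h2 le_rfl (Real.sqrt_nonneg _)
    (by rw [Real.sq_sqrt (by linarith)]; ring) hc hd
  have l1 : √(p - 1) ≤ 1 := Real.sqrt_le_one.2 (by linarith)
  have l2 : √(q - 1) ≤ 1 := Real.sqrt_le_one.2 (by linarith)
  have l3 := Real.sqrt_nonneg (p - 1)
  have l4 := Real.sqrt_nonneg (q - 1)
  set s := √(p - 1)
  set t := √(q - 1)
  have h1 : 0 ≤ (1 + s) / 2 := by linarith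
  have h2' : 0 ≤ (1 - s) / 2 := by linarith
  have h3' : 0 ≤ (1 + t) / 2 := by linarith
  have h4 : 0 ≤ (1 - t) / 2 := by linarith
  refine le_trans ?_ ((holder2 Real.HolderConjugate.two_two
    (a := (1 + s) / 2 * a + (1 - s) / 2 * b) (b := (1 - s) / 2 * a + (1 + s) / 2 * b)
    (c := (1 + t) / 2 * c + (1 - t) / 2 * d) (d := (1 - t) / 2 * c + (1 + t) / 2 * d)
    (by positivity) (by positivity) (by positivity) (by positivity)).trans
    (mul_le_mul b1 b2 (by positivity) (by positivity)))
  rw [← hs]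
  apply le_of_eq; ring

/-- One-coordinate joint weights. -/
noncomputable def bitW (ε : ℝ) (a b : Bool) : ℝ := if a = b then (1 - ε) / 2 else ε / 2

/-- Joint weights on pairs of strings. -/
noncomputable def strW (ε : ℝ) {n : ℕ} (x y : Fin n → Bool) : ℝ := ∏ i, bitW ε (x i) (y i)

lemma sum_cons_bool {n : ℕ} (F : (Fin (n + 1) → Bool) → ℝ) :
    ∑ x, F x = ∑ a : Bool, ∑ x : Fin n → Bool, F (Fin.cons a x) := by
  rw [← (Fin.consEquiv (fun _ : Fin (n + 1) => Bool)).sum_comp, Fintype.sum_prod_type]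
  rfl

lemma strW_cons (ε : ℝ) {n : ℕ} (a b : Bool) (x y : Fin n → Bool) :
    strW ε (Fin.cons a x : Fin (n + 1) → Bool) (Fin.cons b y) = bitW ε a b * strW ε x y := by
  simp [strW, Fin.prod_univ_succ]

lemma strW_nonneg {ε : ℝ} (h0 : 0 ≤ ε) (h1 : ε ≤ 1) {n : ℕ} (x y : Fin n → Bool) :
    0 ≤ strW ε x y := by
  refine Finset.prod_nonneg fun i _ => ?_
  unfold bitW
  split_ifs <;> linarith

lemma bitW_sum_right (ε : ℝ) (a : Bool) : ∑ b, bitW ε a b = 1 / 2 := by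
  cases a <;> simp [bitW] <;> ring

lemma strW_sum_right (ε : ℝ) {n : ℕ} (x : Fin n → Bool) : ∑ y, strW ε x y = 1 / 2 ^ n := by
  unfold strW
  rw [← Fintype.prod_sum (fun i b => bitW ε (x i) b)]
  simp_rw [bitW_sum_right]
  simp

lemma hyper {ε p q : ℝ} (h0 : 0 ≤ ε) (h1 : ε ≤ 1 / 2) (hp : 1 < p) (hq : 1 < q)
    (hpq : (p - 1) * (q - 1) = (1 - 2 * ε) ^ 2) (n : ℕ) :
    ∀ F G : (Fin n → Bool) → ℝ, (∀ x, 0 ≤ F x) → (∀ x, 0 ≤ G x) →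
    ∑ x, ∑ y, strW ε x y * (F x * G y) ≤
      ((∑ x, F x ^ p) / 2 ^ n) ^ (1 / p) * ((∑ x, G x ^ q) / 2 ^ n) ^ (1 / q) := by
  have hp0 : p ≠ 0 := by linarith
  have hq0 : q ≠ 0 := by linarith
  induction n with
  | zero =>
    intro F G hF hG
    simp [strW, ← rpow_mul (hF _), ← rpow_mul (hG _), hp0, hq0]
  | succ n ih =>
    intro F G hF hG
    set f : Bool → ℝ := fun a => ((∑ x : Fin n → Bool, F (Fin.cons a x) ^ p) / 2 ^ n) ^ (1 / p)
      with hf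
    set g : Bool → ℝ := fun a => ((∑ x : Fin n → Bool, G (Fin.cons a x) ^ q) / 2 ^ n) ^ (1 / q)
      with hg
    have hFs : ∀ a, 0 ≤ (∑ x : Fin n → Bool, F (Fin.cons a x) ^ p) / 2 ^ n := fun a =>
      div_nonneg (Finset.sum_nonneg fun x _ => rpow_nonneg (hF _) _) (by positivity)
    have hGs : ∀ a, 0 ≤ (∑ x : Fin n → Bool, G (Fin.cons a x) ^ q) / 2 ^ n := fun a =>
      div_nonneg (Finset.sum_nonneg fun x _ => rpow_nonneg (hG _) _) (by positivity)
    have hf0 : ∀ a, 0 ≤ f a := fun a => rpow_nonneg (hFs a) _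
    have hg0 : ∀ a, 0 ≤ g a := fun a => rpow_nonneg (hGs a) _
    have hfp : ∀ a, f a ^ p = (∑ x : Fin n → Bool, F (Fin.cons a x) ^ p) / 2 ^ n := by
      intro a
      rw [hf]; dsimp only
      rw [← rpow_mul (hFs a), one_div_mul_cancel hp0, rpow_one]
    have hgq : ∀ a, g a ^ q = (∑ x : Fin n → Bool, G (Fin.cons a x) ^ q) / 2 ^ n := by
      intro a
      rw [hg]; dsimp only
      rw [← rpow_mul (hGs a), one_div_mul_cancel hq0, rpow_one]
    have step : ∑ x, ∑ y, strW ε x y * (F x * G y) ≤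
        ∑ a : Bool, ∑ b : Bool, bitW ε a b * (f a * g b) := by
      rw [sum_cons_bool]
      refine Finset.sum_le_sum fun a _ => ?_
      simp_rw [sum_cons_bool (n := n)]
      rw [Finset.sum_comm]
      refine Finset.sum_le_sum fun b _ => ?_
      simp_rw [strW_cons, mul_assoc, ← Finset.mul_sum]
      refine mul_le_mul_of_nonneg_left ?_ (by unfold bitW; split_ifs <;> linarith)
      exact ih (fun x => F (Fin.cons a x)) (fun y => G (Fin.cons b y)) (fun _ => hF _)
        (fun _ => hG _)
    refine step.trans ?_
    have tp := two_point hp hq (r := 1 - 2 * ε) (by linarith) (by linarith) hpq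
      (hf0 true) (hf0 false) (hg0 true) (hg0 false)
    have eF : (∑ x, F x ^ p) / 2 ^ (n + 1) = (f true ^ p + f false ^ p) / 2 := by
      rw [hfp, hfp, sum_cons_bool, Fintype.sum_bool, pow_succ]
      field_simp
    have eG : (∑ x, G x ^ q) / 2 ^ (n + 1) = (g true ^ q + g false ^ q) / 2 := by
      rw [hgq, hgq, sum_cons_bool, Fintype.sum_bool, pow_succ]
      field_simp
    rw [eF, eG]
    refine le_trans (le_of_eq ?_) tp
    simp [bitW]
    ring

instance (ε : ℝ) : IsFiniteMeasure (dsbsPair ε) := by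
  unfold dsbsPair
  constructor
  simp [ENNReal.add_lt_top]

lemma dsbsPair_singleton {ε : ℝ} (a b : Bool) :
    dsbsPair ε {(a, b)} = ENNReal.ofReal (bitW ε a b) := by
  cases a <;> cases b <;> simp [dsbsPair, bitW]

lemma dsbs_singleton {ε : ℝ} (h0 : 0 ≤ ε) (h1 : ε ≤ 1) (n : ℕ) (x y : Fin n → Bool) :
    dsbs ε n {(x, y)} = ENNReal.ofReal (strW ε x y) := by
  unfold dsbs
  rw [Measure.map_apply (by fun_prop) (MeasurableSet.singleton _)]
  have : (fun f : Fin n → Bool × Bool => ((fun i => (f i).1, fun i => (f i).2) :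
      (Fin n → Bool) × (Fin n → Bool))) ⁻¹' {(x, y)} = {fun i => (x i, y i)} := by
    ext f
    simp only [Set.mem_preimage, Set.mem_singleton_iff, Prod.mk.injEq, funext_iff, Prod.ext_iff]
    exact ⟨fun h i => ⟨h.1 i, h.2 i⟩, fun h => ⟨fun i => (h i).1, fun i => (h i).2⟩⟩
  rw [this, Measure.pi_singleton]
  simp_rw [dsbsPair_singleton]
  rw [strW, ENNReal.ofReal_prod_of_nonneg]
  intro i _
  unfold bitW
  split_ifs <;> linarith

open Classical in
lemma dsbs_toReal {ε : ℝ} (h0 : 0 ≤ ε) (h1 : ε ≤ 1) (n : ℕ)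
    (P : (Fin n → Bool) × (Fin n → Bool) → Prop) :
    (dsbs ε n {p | P p}).toReal = ∑ x, ∑ y, strW ε x y * (if P (x, y) then 1 else 0) := by
  have e : ({p | P p} : Set ((Fin n → Bool) × (Fin n → Bool))) =
      ((Finset.univ.filter P : Finset _) : Set _) := by ext; simp
  rw [e, ← sum_measure_singleton, ENNReal.toReal_sum]
  · rw [Finset.sum_filter, Fintype.sum_prod_type]
    refine Finset.sum_congr rfl fun x _ => Finset.sum_congr rfl fun y _ => ?_
    rw [dsbs_singleton h0 h1, ENNReal.toReal_ofReal (strW_nonneg h0 h1 x y)]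
    split_ifs <;> simp
  · rintro ⟨x, y⟩ _
    rw [dsbs_singleton h0 h1]
    exact ENNReal.ofReal_ne_top

open Classical in
lemma event_expand {ε : ℝ} {n b : ℕ} {S : Type*} [Fintype S] (f : (Fin n → Bool) → S)
    (g : Fin b → (Fin n → Bool) → S) :
    ∑ x, ∑ y, strW ε x y * (if ∃ i : Fin b, f x = g i y then (1 : ℝ) else 0) =
    ∑ z : S, ∑ x, ∑ y, strW ε x y * ((if f x = z then (1 : ℝ) else 0) *
      (if ∃ i : Fin b, z = g i y then (1 : ℝ) else 0)) := by
  symm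
  rw [Finset.sum_comm]
  refine Finset.sum_congr rfl fun x _ => ?_
  rw [Finset.sum_comm]
  refine Finset.sum_congr rfl fun y _ => ?_
  rw [← Finset.mul_sum]
  congr 1
  simp only [ite_mul, one_mul, zero_mul, Finset.sum_ite_eq, Finset.mem_univ, if_true]

open Classical in
lemma list_sum_le {n b : ℕ} {S : Type*} [Fintype S] (g : Fin b → (Fin n → Bool) → S) :
    ∑ z : S, (∑ y, (if ∃ i : Fin b, z = g i y then (1 : ℝ) else 0)) / 2 ^ n ≤ b := by
  rw [← Finset.sum_div, Finset.sum_comm, div_le_iff₀ (by positivity)]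
  have h : ∀ y : Fin n → Bool, ∑ z : S, (if ∃ i : Fin b, z = g i y then (1 : ℝ) else 0) ≤ b := by
    intro y
    calc _ ≤ ∑ z : S, ∑ i : Fin b, (if z = g i y then (1 : ℝ) else 0) := by
          refine Finset.sum_le_sum fun z _ => ?_
          split_ifs with hz
          · obtain ⟨i, hi⟩ := hz
            refine le_trans ?_ (Finset.single_le_sum (f := fun i => if z = g i y then (1 : ℝ) else 0)
              (fun j _ => by positivity) (Finset.mem_univ i))
            simp [hi]
          · positivity
      _ = b := by
          rw [Finset.sum_comm]
          simp
  calc _ ≤ ∑ y : Fin n → Bool, (b : ℝ) := Finset.sum_le_sum fun y _ => h y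
    _ = _ := by simp; ring

lemma holder_opt {S : Type*} [Fintype S] {p q κ β : ℝ} (a c : S → ℝ) (hp : 1 < p) (hq : 1 < q)
    (hpq : (p - 1) * (q - 1) ≤ 1) (ha : ∀ z, 0 ≤ a z) (hc : ∀ z, 0 ≤ c z)
    (haκ : ∀ z, a z ≤ 2 ^ (-κ)) (hsa : ∑ z, a z ≤ 1) (hsc : ∑ z, c z ≤ 2 ^ β) :
    ∑ z, a z ^ (1 / p) * c z ^ (1 / q) ≤ (2 : ℝ) ^ (-κ * (1 / p + 1 / q - 1) + β * (1 / q)) := by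
  have hp0 : 0 < p := by linarith
  have hq0 : 0 < q := by linarith
  have hq1 : 0 < q - 1 := by linarith
  have hconj : (q / (q - 1)).HolderConjugate q :=
    (Real.HolderConjugate.conjExponent hq).symm
  have hk : 0 ≤ q / (q - 1) / p - 1 := by
    rw [sub_nonneg, div_div, le_div_iff₀ (by positivity)]
    nlinarith
  refine (Real.inner_le_Lp_mul_Lq_of_nonneg Finset.univ hconj
    (fun z _ => rpow_nonneg (ha z) _) (fun z _ => rpow_nonneg (hc z) _)).trans ?_
  rw [rpow_add (by norm_num)]
  refine mul_le_mul ?_ ?_ ?_ (by positivity)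
  · have h1 : ∑ z, (a z ^ (1 / p)) ^ (q / (q - 1)) ≤ (2 : ℝ) ^ (-κ * (q / (q - 1) / p - 1)) := by
      calc _ ≤ ∑ z, a z * (2 : ℝ) ^ (-κ * (q / (q - 1) / p - 1)) := by
            refine Finset.sum_le_sum fun z _ => ?_
            rw [← rpow_mul (ha z), show 1 / p * (q / (q - 1)) = 1 + (q / (q - 1) / p - 1) by ring,
              rpow_add_of_nonneg (ha z) zero_le_one hk, rpow_one, rpow_mul (by norm_num)]
            exact mul_le_mul_of_nonneg_left (rpow_le_rpow (ha z) (haκ z) hk) (ha z)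
        _ = (∑ z, a z) * (2 : ℝ) ^ (-κ * (q / (q - 1) / p - 1)) := by rw [Finset.sum_mul]
        _ ≤ 1 * (2 : ℝ) ^ (-κ * (q / (q - 1) / p - 1)) := by gcongr
        _ = _ := one_mul _
    have h0 : 0 ≤ ∑ z, (a z ^ (1 / p)) ^ (q / (q - 1)) :=
      Finset.sum_nonneg fun z _ => rpow_nonneg (rpow_nonneg (ha z) _) _
    refine (rpow_le_rpow h0 h1 (by positivity)).trans (le_of_eq ?_)
    rw [← rpow_mul (by norm_num)]
    congr 1
    field_simp
    ring
  · have e : ∀ z, (c z ^ (1 / q)) ^ q = c z := fun z => by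
      rw [← rpow_mul (hc z), one_div_mul_cancel hq0.ne', rpow_one]
    simp_rw [e]
    rw [rpow_mul (by norm_num)]
    exact rpow_le_rpow (Finset.sum_nonneg fun z _ => hc z) hsc (by positivity)
  · exact rpow_nonneg (Finset.sum_nonneg fun z _ => rpow_nonneg (rpow_nonneg (hc z) _) _) _

theorem non_interactive_list_common_randomness_converse
    (ε : ℝ) (hε0 : 0 < ε) (hε1 : ε ≤ 1 / 2)
    (n b : ℕ) (hn : 1 ≤ n) (hb : 1 ≤ b)
    (κ : ℝ) (hκ : 0 < κ) (hbκ : Real.logb 2 b ≤ 4 * ε * (1 - ε) * κ)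
    (S : Type*) [Fintype S]
    (f : (Fin n → Bool) → S)
    (hf : ∀ z : S, ((dsbs ε n) {p | f p.1 = z}).toReal ≤ 2 ^ (-κ))
    (g : Fin b → (Fin n → Bool) → S) :
    ((dsbs ε n) {p | ∃ i : Fin b, f p.1 = g i p.2}).toReal ≤
      2 ^ (-((Real.sqrt (1 - Real.logb 2 b / κ) - (1 - 2 * ε)) ^ 2 /
        (4 * ε * (1 - ε)) * κ)) := by
  classical
  have he0 : 0 ≤ ε := hε0.le
  have he1 : ε ≤ 1 := by linarith
  have hc0 : 0 < 4 * ε * (1 - ε) := by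
    have : 0 < 1 - ε := by linarith
    positivity
  have hb1 : (1 : ℝ) ≤ b := by exact_mod_cast hb
  have hL0 : 0 ≤ Real.logb 2 b := Real.logb_nonneg (by norm_num) hb1
  have hbL : (b : ℝ) = 2 ^ Real.logb 2 b :=
    (Real.rpow_logb (by norm_num) (by norm_num) (by linarith)).symm
  set L := Real.logb 2 b with hL
  have hx : (1 - 2 * ε) ^ 2 ≤ 1 - L / κ := by
    have : L / κ ≤ 4 * ε * (1 - ε) := by rwa [div_le_iff₀ hκ]
    nlinarith
  have hs2 : √(1 - L / κ) ^ 2 = 1 - L / κ := Real.sq_sqrt (le_trans (sq_nonneg _) hx)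
  have hsρ : 1 - 2 * ε ≤ √(1 - L / κ) := Real.le_sqrt_of_sq_le hx
  have hs1 : √(1 - L / κ) ≤ 1 := Real.sqrt_le_one.2 (by
    have : 0 ≤ L / κ := by positivity
    linarith)
  set s := √(1 - L / κ) with hs
  have hLs : L = κ * (1 - s ^ 2) := by rw [hs2]; field_simp; ring
  -- the expansion of the probability
  rw [dsbs_toReal he0 he1 n (fun p => ∃ i : Fin b, f p.1 = g i p.2)]
  dsimp only
  set A : S → (Fin n → Bool) → ℝ := fun z x => if f x = z then 1 else 0 with hA
  set B : S → (Fin n → Bool) → ℝ := fun z y => if ∃ i : Fin b, z = g i y then 1 else 0 with hB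
  have hA0 : ∀ z x, 0 ≤ A z x := fun z x => by simp only [hA]; positivity
  have hB0 : ∀ z x, 0 ≤ B z x := fun z x => by simp only [hB]; positivity
  have haκ : ∀ z, (∑ x, A z x) / 2 ^ n ≤ 2 ^ (-κ) := by
    intro z
    refine le_trans (le_of_eq ?_) (hf z)
    rw [dsbs_toReal he0 he1 n (fun p => f p.1 = z)]
    rw [Finset.sum_div]
    refine Finset.sum_congr rfl fun x _ => ?_
    rw [div_eq_mul_one_div, ← strW_sum_right ε x, mul_comm, Finset.sum_mul]
  have hsa : ∑ z, (∑ x, A z x) / 2 ^ n = 1 := by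
    rw [← Finset.sum_div, Finset.sum_comm]
    simp [hA]
  have hsb : ∑ z, (∑ y, B z y) / 2 ^ n ≤ 2 ^ L := by
    rw [← hbL]; exact list_sum_le g
  have ha0 : ∀ z, 0 ≤ (∑ x, A z x) / 2 ^ n := fun z =>
    div_nonneg (Finset.sum_nonneg fun x _ => hA0 z x) (by positivity)
  have hb0 : ∀ z, 0 ≤ (∑ x, B z x) / 2 ^ n := fun z =>
    div_nonneg (Finset.sum_nonneg fun x _ => hB0 z x) (by positivity)
  rcases eq_or_lt_of_le hsρ with hEq | hlt
  · -- trivial bound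
    rw [← hEq]
    simp only [sub_self]
    norm_num
    calc _ ≤ ∑ x : Fin n → Bool, ∑ y, strW ε x y := by
          refine Finset.sum_le_sum fun x _ => Finset.sum_le_sum fun y _ => ?_
          have := strW_nonneg he0 he1 x y
          split_ifs <;> simp [this]
      _ = 1 := by simp_rw [strW_sum_right]; simp
  refine le_trans (le_of_eq (Eq.trans ?_ (event_expand (ε := ε) f g))) ?_
  · refine Finset.sum_congr rfl fun x _ => Finset.sum_congr rfl fun y _ => ?_
    congr
  rcases eq_or_lt_of_le hε1 with hhalf | hlt2
  · -- independent case
    have hW : ∀ x y : Fin n → Bool, strW ε x y = 1 / 2 ^ n * (1 / 2 ^ n) := by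
      intro x y
      have : ∀ a b : Bool, bitW ε a b = 1 / 2 * (1 / 2) := by
        intro a b; unfold bitW; rw [hhalf]; split_ifs <;> norm_num
      unfold strW
      simp_rw [this]
      rw [Finset.prod_const, mul_pow]
      simp
    calc ∑ z : S, ∑ x, ∑ y, strW ε x y * (A z x * B z y)
        = ∑ z : S, (∑ x, A z x) / 2 ^ n * ((∑ y, B z y) / 2 ^ n) := by
          refine Finset.sum_congr rfl fun z _ => ?_
          rw [div_mul_div_comm, Finset.sum_mul_sum, Finset.sum_div]
          refine Finset.sum_congr rfl fun x _ => ?_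
          rw [Finset.sum_div]
          refine Finset.sum_congr rfl fun y _ => ?_
          rw [hW]; field_simp
      _ ≤ ∑ z : S, 2 ^ (-κ) * ((∑ y, B z y) / 2 ^ n) :=
          Finset.sum_le_sum fun z _ => mul_le_mul_of_nonneg_right (haκ z) (hb0 z)
      _ ≤ 2 ^ (-κ) * 2 ^ L := by
          rw [← Finset.mul_sum]
          exact mul_le_mul_of_nonneg_left hsb (by positivity)
      _ = _ := by
          rw [← rpow_add (by norm_num)]
          congr 1
          rw [hhalf, hLs]
          ring
  · have hρ : 0 < 1 - 2 * ε := by linarith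
    have hc : 4 * ε * (1 - ε) = 1 - (1 - 2 * ε) ^ 2 := by ring
    rw [hc] at hc0 ⊢
    set ρ := 1 - 2 * ε with hρd
    have hs0 : 0 < s := by linarith
    have hρ1 : ρ < 1 := by linarith
    have hd1 : 0 < 1 - ρ * s := by nlinarith
    have hd2 : 0 < s - ρ := by linarith
    have hp1 : (1 - ρ ^ 2) / (1 - ρ * s) - 1 = ρ * (s - ρ) / (1 - ρ * s) := by
      field_simp; ring
    have hq1 : s * (1 - ρ ^ 2) / (s - ρ) - 1 = ρ * (1 - ρ * s) / (s - ρ) := by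
      field_simp; ring
    have hpq : ((1 - ρ ^ 2) / (1 - ρ * s) - 1) * (s * (1 - ρ ^ 2) / (s - ρ) - 1) = ρ ^ 2 := by
      rw [hp1, hq1]; field_simp
    have hp : 1 < (1 - ρ ^ 2) / (1 - ρ * s) := by
      rw [← sub_pos, hp1]; positivity
    have hq : 1 < s * (1 - ρ ^ 2) / (s - ρ) := by
      rw [← sub_pos, hq1]; positivity
    have ep : 1 / ((1 - ρ ^ 2) / (1 - ρ * s)) = (1 - ρ * s) / (1 - ρ ^ 2) := one_div_div _ _
    have eq : 1 / (s * (1 - ρ ^ 2) / (s - ρ)) = (s - ρ) / (s * (1 - ρ ^ 2)) := one_div_div _ _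
    set p := (1 - ρ ^ 2) / (1 - ρ * s)
    set q := s * (1 - ρ ^ 2) / (s - ρ)
    have hp0 : p ≠ 0 := by linarith
    have hq0 : q ≠ 0 := by linarith
    have hop := holder_opt (κ := κ) (β := L) (fun z => (∑ x, A z x) / 2 ^ n)
      (fun z => (∑ x, B z x) / 2 ^ n) hp hq (by rw [hpq]; nlinarith) ha0 hb0 haκ hsa.le hsb
    have hAp : ∀ z x, A z x ^ p = A z x := fun z x => by
      simp only [hA]; split_ifs <;> simp [hp0]
    have hBq : ∀ z x, B z x ^ q = B z x := fun z x => by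
      simp only [hB]; split_ifs <;> simp [hq0]
    calc ∑ z : S, ∑ x, ∑ y, strW ε x y * (A z x * B z y)
        ≤ ∑ z : S, ((∑ x, A z x) / 2 ^ n) ^ (1 / p) * ((∑ x, B z x) / 2 ^ n) ^ (1 / q) := by
          refine Finset.sum_le_sum fun z _ => ?_
          have := hyper he0 hε1 hp hq hpq n (A z) (B z) (hA0 z) (hB0 z)
          simpa only [hAp, hBq] using this
      _ ≤ _ := hop
      _ = _ := by
          congr 1
          rw [ep, eq, hLs]
          field_simp
          ring
end
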